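/- arXiv:2006.03118 — 2 statements merged into one kernel-verified Lean document; each statement's English description precedes it below -/
import Mathlib

section
/- Let P₁ = ℝ^d × {0} ⊂ ℝⁿ and P₂ = {(x, xa+b) : x ∈ ℝ^d} for a d×(n−d) matrix a and b ∈ ℝ^{n−d}, with flat measures μᵢ = cᵢ μ_{Pᵢ}, c₂ ≤ c₁, both planes intersecting B(x₀, r/2) with x₀ ∈ B(0,r/2). Then dist_{x₀,r}(μ₁,μ₂) ≤ C [ c₁(|a| + |b|/r) + (c₁ − c₂) ] for C depending only on n, d. -/
open MeasureTheory Metric Set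

noncomputable section

/-- `Lip x r`: the set of 1-Lipschitz functions supported in the closed ball `B̄(x,r)`. -/
def LipIn {E : Type*} [NormedAddCommGroup E] (x : E) (r : ℝ) : Set (E → ℝ) :=
  {f | LipschitzWith 1 f ∧ ∀ y ∉ closedBall x r, f y = 0}

/-- Normalized Wasserstein distance `dist_{x,r}(μ,ν)`. -/
def wdist {E : Type*} [NormedAddCommGroup E] [MeasurableSpace E] (d : ℕ) (x : E) (r : ℝ)
    (μ ν : Measure E) : ℝ :=
  r ^ (-(d : ℝ) - 1) * ⨆ f : LipIn x r, |∫ y, f.1 y ∂μ - ∫ y, f.1 y ∂ν|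

/-- The graph `{(x, xa+b)} ⊂ ℝ^{d+m}` of the affine map `x ↦ xa + b`. -/
def graphPlane (d m : ℕ) (a : Fin d → Fin m → ℝ) (b : Fin m → ℝ) :
    Set (EuclideanSpace ℝ (Fin (d + m))) :=
  {X | ∀ j : Fin m, X (Fin.natAdd d j) = (∑ i, a i j * X (Fin.castAdd m i)) + b j}

/-- A (Frobenius) matrix norm. -/
def matNorm {d m : ℕ} (a : Fin d → Fin m → ℝ) : ℝ :=
  Real.sqrt (∑ i, ∑ j, (a i j) ^ 2)

/-- Euclidean norm of a vector of `ℝ^m`. -/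
def vecNorm {m : ℕ} (b : Fin m → ℝ) : ℝ :=
  Real.sqrt (∑ j, (b j) ^ 2)

/-- The map `x ↦ x a` from `ℝ^d` to `ℝ^m`. -/
def rowMul {d m : ℕ} (a : Fin d → Fin m → ℝ) (x : EuclideanSpace ℝ (Fin d)) :
    EuclideanSpace ℝ (Fin m) :=
  WithLp.toLp 2 fun j => ∑ i, a i j * x i

/-- The identification of a pair `(x, y)` with a point of `ℝ^{d+m}`. -/
def euclAppend {d m : ℕ} (x : EuclideanSpace ℝ (Fin d)) (y : EuclideanSpace ℝ (Fin m)) :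
    EuclideanSpace ℝ (Fin (d + m)) :=
  WithLp.toLp 2 (Fin.append x y)

/-- The linear map `x ↦ (x, x a)`. -/
def graphLin {d m : ℕ} (a : Fin d → Fin m → ℝ) :
    EuclideanSpace ℝ (Fin d) →ₗ[ℝ] EuclideanSpace ℝ (Fin (d + m)) where
  toFun x := euclAppend x (rowMul a x)
  map_add' x y := by
    ext k
    refine Fin.addCases (fun i => ?_) (fun j => ?_) k
    · simp [euclAppend]
    · simp [euclAppend, rowMul, mul_add, Finset.sum_add_distrib]
  map_smul' c x := by
    ext k
    refine Fin.addCases (fun i => ?_) (fun j => ?_) k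
    · simp [euclAppend]
    · simp [euclAppend, rowMul, Finset.mul_sum, mul_left_comm]

/-- The parametrization `x ↦ (x, x a + b)` of `graphPlane d m a b`. -/
def graphMap {d m : ℕ} (a : Fin d → Fin m → ℝ) (b : Fin m → ℝ)
    (x : EuclideanSpace ℝ (Fin d)) : EuclideanSpace ℝ (Fin (d + m)) :=
  graphLin a x + euclAppend 0 (WithLp.toLp 2 b)

/-- The projection of `ℝ^{d+m}` onto its first `d` coordinates. -/
def projFirst {d m : ℕ} (X : EuclideanSpace ℝ (Fin (d + m))) : EuclideanSpace ℝ (Fin d) :=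
  WithLp.toLp 2 fun i => X (Fin.castAdd m i)

section Geometry

variable {d m : ℕ} (a : Fin d → Fin m → ℝ) (b : Fin m → ℝ)

lemma norm_euclAppend_sq (x : EuclideanSpace ℝ (Fin d)) (y : EuclideanSpace ℝ (Fin m)) :
    ‖euclAppend x y‖ ^ 2 = ‖x‖ ^ 2 + ‖y‖ ^ 2 := by
  simp [EuclideanSpace.norm_sq_eq, euclAppend, Fin.sum_univ_add]

lemma norm_euclAppend_le (x : EuclideanSpace ℝ (Fin d)) (y : EuclideanSpace ℝ (Fin m)) :
    ‖euclAppend x y‖ ≤ ‖x‖ + ‖y‖ := by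
  have := norm_euclAppend_sq x y
  refine abs_le_of_sq_le_sq' ?_ (by positivity) |>.2
  nlinarith [norm_nonneg x, norm_nonneg y, mul_nonneg (norm_nonneg x) (norm_nonneg y)]

lemma norm_le_norm_euclAppend (x : EuclideanSpace ℝ (Fin d)) (y : EuclideanSpace ℝ (Fin m)) :
    ‖x‖ ≤ ‖euclAppend x y‖ := by
  have := norm_euclAppend_sq x y
  exact abs_le_of_sq_le_sq' (by nlinarith [sq_nonneg ‖y‖]) (norm_nonneg _) |>.2

lemma euclAppend_sub (x x' : EuclideanSpace ℝ (Fin d)) (y y' : EuclideanSpace ℝ (Fin m)) :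
    euclAppend x y - euclAppend x' y' = euclAppend (x - x') (y - y') := by
  ext k
  refine Fin.addCases (fun i => ?_) (fun j => ?_) k <;> simp [euclAppend]

lemma euclAppend_add (x x' : EuclideanSpace ℝ (Fin d)) (y y' : EuclideanSpace ℝ (Fin m)) :
    euclAppend x y + euclAppend x' y' = euclAppend (x + x') (y + y') := by
  ext k
  refine Fin.addCases (fun i => ?_) (fun j => ?_) k <;> simp [euclAppend]

lemma matNorm_nonneg : 0 ≤ matNorm a := Real.sqrt_nonneg _

lemma vecNorm_nonneg : 0 ≤ vecNorm b := Real.sqrt_nonneg _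

lemma norm_toLp_eq_vecNorm : ‖(WithLp.toLp 2 b : EuclideanSpace ℝ (Fin m))‖ = vecNorm b := by
  simp [EuclideanSpace.norm_eq, vecNorm]

lemma norm_rowMul_le (x : EuclideanSpace ℝ (Fin d)) : ‖rowMul a x‖ ≤ matNorm a * ‖x‖ := by
  refine abs_le_of_sq_le_sq' ?_ (mul_nonneg (matNorm_nonneg a) (norm_nonneg x)) |>.2
  have h : matNorm a ^ 2 = ∑ i, ∑ j, (a i j) ^ 2 :=
    Real.sq_sqrt (Finset.sum_nonneg fun i _ => Finset.sum_nonneg fun j _ => sq_nonneg _)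
  rw [mul_pow, h, Finset.sum_comm, Finset.sum_mul, EuclideanSpace.norm_sq_eq,
    EuclideanSpace.norm_sq_eq]
  refine Finset.sum_le_sum fun j _ => ?_
  simpa [rowMul] using Finset.sum_mul_sq_le_sq_mul_sq Finset.univ (fun i => a i j) (fun i => x i)

lemma norm_le_norm_graphLin (x : EuclideanSpace ℝ (Fin d)) : ‖x‖ ≤ ‖graphLin a x‖ :=
  norm_le_norm_euclAppend x _

lemma norm_graphLin_le (x : EuclideanSpace ℝ (Fin d)) :
    ‖graphLin a x‖ ≤ (1 + matNorm a) * ‖x‖ := by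
  have h1 : ‖graphLin a x‖ ≤ ‖x‖ + ‖rowMul a x‖ := norm_euclAppend_le x _
  linarith [norm_rowMul_le a x]

lemma graphMap_sub_graphMap (x y : EuclideanSpace ℝ (Fin d)) :
    graphMap a b x - graphMap a b y = graphLin a (x - y) := by
  simp [graphMap]

lemma lipschitzWith_graphMap : LipschitzWith (1 + (matNorm a).toNNReal) (graphMap a b) :=
  LipschitzWith.of_dist_le_mul fun x y => by
    rw [dist_eq_norm, dist_eq_norm, graphMap_sub_graphMap]
    simpa [Real.coe_toNNReal _ (matNorm_nonneg a)] using norm_graphLin_le a (x - y)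

lemma antilipschitzWith_graphMap : AntilipschitzWith 1 (graphMap a b) :=
  AntilipschitzWith.of_le_mul_dist fun x y => by
    rw [dist_eq_norm, dist_eq_norm, graphMap_sub_graphMap]
    simpa using norm_le_norm_graphLin a (x - y)

lemma measurableEmbedding_graphMap : MeasurableEmbedding (graphMap a b) :=
  ((antilipschitzWith_graphMap a b).isClosedEmbedding
    (lipschitzWith_graphMap a b).uniformContinuous).measurableEmbedding

lemma graphMap_eq (x : EuclideanSpace ℝ (Fin d)) :
    graphMap a b x = euclAppend x (rowMul a x + WithLp.toLp 2 b) := by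
  simp [graphMap, graphLin, euclAppend_add]

lemma range_graphMap : range (graphMap a b) = graphPlane d m a b := by
  ext X
  constructor
  · rintro ⟨x, rfl⟩ j
    simp [graphMap_eq, euclAppend, rowMul]
  · intro hX
    refine ⟨projFirst X, ?_⟩
    rw [graphMap_eq]
    ext k
    refine Fin.addCases (fun i => ?_) (fun j => ?_) k
    · simp [euclAppend, projFirst]
    · simpa [euclAppend, projFirst, rowMul] using (hX j).symm

lemma projFirst_graphMap (x : EuclideanSpace ℝ (Fin d)) : projFirst (graphMap a b x) = x := by
  ext i
  simp [graphMap_eq, euclAppend, projFirst]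

lemma dist_projFirst_le (X Y : EuclideanSpace ℝ (Fin (d + m))) :
    dist (projFirst X) (projFirst Y) ≤ dist X Y := by
  have h (Z : EuclideanSpace ℝ (Fin (d + m))) :
      euclAppend (projFirst Z) (WithLp.toLp 2 fun j => Z (Fin.natAdd d j)) = Z := by
    ext k
    refine Fin.addCases (fun i => ?_) (fun j => ?_) k <;> simp [euclAppend, projFirst]
  rw [dist_eq_norm, dist_eq_norm, ← h X, ← h Y, euclAppend_sub]
  simpa [h] using norm_le_norm_euclAppend _ _

lemma dist_graphMap_zero_le (x : EuclideanSpace ℝ (Fin d)) :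
    dist (graphMap 0 0 x) (graphMap a b x) ≤ matNorm a * ‖x‖ + vecNorm b := by
  have h0 : rowMul (0 : Fin d → Fin m → ℝ) x = 0 := by ext j; simp [rowMul]
  rw [dist_comm, dist_eq_norm, graphMap_eq, graphMap_eq, euclAppend_sub, h0]
  refine (norm_euclAppend_le _ _).trans ?_
  have h := norm_add_le (rowMul a x) (WithLp.toLp 2 b)
  rw [norm_toLp_eq_vecNorm b] at h
  have h' : ‖x - x‖ = 0 := by simp
  have h'' : (WithLp.toLp 2 (0 : Fin m → ℝ) : EuclideanSpace ℝ (Fin m)) = 0 := rfl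
  rw [h'', h', add_zero, sub_zero]
  linarith [norm_rowMul_le a x]

end Geometry

section Measures

variable {d m : ℕ} (a : Fin d → Fin m → ℝ) (b : Fin m → ℝ)

lemma hausdorffMeasure_le_comap_graphMap :
    (μH[(d : ℝ)] : Measure (EuclideanSpace ℝ (Fin d))) ≤
      (μH[(d : ℝ)] : Measure (EuclideanSpace ℝ (Fin (d + m)))).comap (graphMap a b) := by
  refine Measure.le_iff.2 fun s hs => ?_
  rw [(measurableEmbedding_graphMap a b).comap_apply]
  simpa using (antilipschitzWith_graphMap a b).le_hausdorffMeasure_image (Nat.cast_nonneg d) s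

lemma comap_graphMap_le :
    (μH[(d : ℝ)] : Measure (EuclideanSpace ℝ (Fin (d + m)))).comap (graphMap a b) ≤
      ENNReal.ofReal ((1 + matNorm a) ^ d) •
        (μH[(d : ℝ)] : Measure (EuclideanSpace ℝ (Fin d))) := by
  refine Measure.le_iff.2 fun s hs => ?_
  rw [(measurableEmbedding_graphMap a b).comap_apply]
  refine ((lipschitzWith_graphMap a b).hausdorffMeasure_image_le (Nat.cast_nonneg d) s).trans ?_
  have h := matNorm_nonneg a
  rw [Measure.smul_apply, smul_eq_mul, ENNReal.rpow_natCast, ENNReal.ofReal_pow (by positivity),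
    ENNReal.ofReal_add zero_le_one h]
  simp [ENNReal.ofReal]

lemma setIntegral_graphPlane (f : EuclideanSpace ℝ (Fin (d + m)) → ℝ) :
    ∫ y in graphPlane d m a b, f y ∂μH[(d : ℝ)] =
      ∫ x, f (graphMap a b x) ∂(μH[(d : ℝ)]).comap (graphMap a b) := by
  rw [← range_graphMap, ← (measurableEmbedding_graphMap a b).map_comap,
    (measurableEmbedding_graphMap a b).integral_map]

lemma hausdorffMeasure_closedBall_real (x : EuclideanSpace ℝ (Fin d)) {r : ℝ} (hr : 0 ≤ r) :
    (μH[(d : ℝ)]).real (closedBall x r) =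
      r ^ d * (μH[(d : ℝ)]).real (closedBall (0 : EuclideanSpace ℝ (Fin d)) 1) := by
  rw [Measure.real, Measure.real, Measure.addHaar_closedBall' _ _ hr]
  simp [ENNReal.toReal_mul, hr]

lemma exists_isometry_graphPlane {p : EuclideanSpace ℝ (Fin (d + m))}
    (hp : p ∈ graphPlane d m a b) :
    ∃ φ : EuclideanSpace ℝ (Fin d) → EuclideanSpace ℝ (Fin (d + m)),
      Isometry φ ∧ φ 0 = p ∧ graphPlane d m a b = range φ := by
  have hinj : Function.Injective (graphLin a) :=
    (injective_iff_map_eq_zero _).2 fun x hx => by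
      have := norm_le_norm_graphLin a x
      rw [hx, norm_zero] at this
      exact norm_le_zero_iff.1 this
  have hrank : Module.finrank ℝ (LinearMap.range (graphLin a)) = d := by
    rw [LinearMap.finrank_range_of_inj hinj, finrank_euclideanSpace_fin]
  let e := ((stdOrthonormalBasis ℝ (LinearMap.range (graphLin a))).reindex (finCongr hrank)).repr
  rw [← range_graphMap] at hp ⊢
  obtain ⟨q, rfl⟩ := hp
  refine ⟨fun v => graphMap a b q + (e.symm v : EuclideanSpace ℝ (Fin (d + m))), ?_, by simp, ?_⟩
  · refine Isometry.of_dist_eq fun v w => ?_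
    rw [dist_add_left, ← Subtype.dist_eq, e.symm.dist_map]
  · ext X
    constructor
    · rintro ⟨x, rfl⟩
      refine ⟨e ⟨graphLin a (x - q), ⟨_, rfl⟩⟩, ?_⟩
      simp [graphMap]
      abel
    · rintro ⟨v, rfl⟩
      obtain ⟨y, hy⟩ := (e.symm v).2
      refine ⟨q + y, ?_⟩
      simp [graphMap, ← hy]
      abel

lemma hausdorffMeasure_graphPlane_inter_closedBall_le (x₀ : EuclideanSpace ℝ (Fin (d + m))) {r : ℝ}
    (hr : 0 ≤ r) :
    μH[(d : ℝ)] (graphPlane d m a b ∩ closedBall x₀ r) ≤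
      ENNReal.ofReal ((2 * r) ^ d *
        (μH[(d : ℝ)]).real (closedBall (0 : EuclideanSpace ℝ (Fin d)) 1)) := by
  rcases (graphPlane d m a b ∩ closedBall x₀ r).eq_empty_or_nonempty with h | ⟨p, hp, hpr⟩
  · simp [h]
  obtain ⟨φ, hφ, rfl, hrange⟩ := exists_isometry_graphPlane a b hp
  have hsub : graphPlane d m a b ∩ closedBall x₀ r ⊆ φ '' closedBall 0 (2 * r) := by
    rw [hrange]
    rintro _ ⟨⟨v, rfl⟩, hv⟩
    refine ⟨v, ?_, rfl⟩
    rw [mem_closedBall, ← hφ.dist_eq]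
    rw [mem_closedBall] at hv hpr
    linarith [dist_triangle_right (φ v) (φ 0) x₀]
  refine (measure_mono hsub).trans ?_
  rw [hφ.hausdorffMeasure_image (Or.inl (Nat.cast_nonneg d)),
    ← hausdorffMeasure_closedBall_real 0 (by positivity : 0 ≤ 2 * r), Measure.real,
    ENNReal.ofReal_toReal measure_closedBall_lt_top.ne]

lemma abs_le_of_mem_LipIn {k : ℕ} (hk : 0 < k) {x₀ : EuclideanSpace ℝ (Fin k)} {r : ℝ} (hr : 0 < r)
    {f : EuclideanSpace ℝ (Fin k) → ℝ} (hf : f ∈ LipIn x₀ r) (y : EuclideanSpace ℝ (Fin k)) :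
    |f y| ≤ 3 * r := by
  by_cases hy : y ∈ closedBall x₀ r
  · have : Nonempty (Fin k) := ⟨⟨0, hk⟩⟩
    obtain ⟨z, hz⟩ := exists_norm_eq (EuclideanSpace ℝ (Fin k)) (by positivity : 0 ≤ 2 * r)
    have hz' : dist (x₀ + z) x₀ = 2 * r := by simp [hz]
    have hfz : f (x₀ + z) = 0 := hf.2 _ fun h => by
      rw [mem_closedBall] at h
      linarith
    have h := hf.1.dist_le_mul y (x₀ + z)
    rw [hfz, Real.dist_eq, sub_zero, NNReal.coe_one, one_mul] at h
    rw [mem_closedBall] at hy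
    linarith [dist_triangle_right y (x₀ + z) x₀]
  · rw [hf.2 y hy, abs_zero]
    positivity

lemma abs_setIntegral_graphPlane_le (hk : 0 < d + m) {x₀ : EuclideanSpace ℝ (Fin (d + m))}
    {r : ℝ} (hr : 0 < r) {f : EuclideanSpace ℝ (Fin (d + m)) → ℝ} (hf : f ∈ LipIn x₀ r) :
    |∫ y in graphPlane d m a b, f y ∂μH[(d : ℝ)]| ≤
      3 * r * ((2 * r) ^ d *
        (μH[(d : ℝ)]).real (closedBall (0 : EuclideanSpace ℝ (Fin d)) 1)) := by
  have hmeas : MeasurableSet (graphPlane d m a b) := by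
    rw [← range_graphMap]
    exact (measurableEmbedding_graphMap a b).measurableSet_range
  have hle := hausdorffMeasure_graphPlane_inter_closedBall_le a b x₀ hr.le
  rw [setIntegral_eq_of_subset_of_forall_sdiff_eq_zero hmeas
    (inter_subset_left (t := closedBall x₀ r)) fun y hy => hf.2 y fun h => hy.2 ⟨hy.1, h⟩]
  rw [← Real.norm_eq_abs]
  refine (norm_setIntegral_le_of_norm_le_const (hle.trans_lt ENNReal.ofReal_lt_top)
    fun y _ => abs_le_of_mem_LipIn hk hr hf y).trans ?_
  gcongr
  exact ENNReal.toReal_le_of_le_ofReal (by positivity) hle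

lemma abs_integral_sub_integral_le {α : Type*} [MeasurableSpace α] {μ ν : Measure α} {K : ℝ}
    (hK : 1 ≤ K) (h₁ : μ ≤ ν) (h₂ : ν ≤ ENNReal.ofReal K • μ) {g : α → ℝ} (hg : Integrable g μ) :
    |∫ x, g x ∂ν - ∫ x, g x ∂μ| ≤ (K - 1) * ∫ x, |g x| ∂μ := by
  have hgK : ∀ {h : α → ℝ}, Integrable h μ → Integrable h (ENNReal.ofReal K • μ) :=
    fun hh => hh.smul_measure ENNReal.ofReal_ne_top
  have hgν : Integrable g ν := (hgK hg).mono_measure h₂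
  have main {h : α → ℝ} (h0 : ∀ x, 0 ≤ h x) (hh : Integrable h μ) :
      ∫ x, h x ∂μ ≤ ∫ x, h x ∂ν ∧ ∫ x, h x ∂ν ≤ K * ∫ x, h x ∂μ := by
    refine ⟨integral_mono_measure h₁ (.of_forall h0) ((hgK hh).mono_measure h₂), ?_⟩
    have := integral_mono_measure h₂ (.of_forall h0) (hgK hh)
    rwa [integral_smul_measure, ENNReal.toReal_ofReal (zero_le_one.trans hK)] at this
  have hp := main (h := fun x => |g x| + g x) (fun x => by linarith [neg_abs_le (g x)])
    (hg.abs.add hg)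
  have hm := main (h := fun x => |g x| - g x) (fun x => by linarith [le_abs_self (g x)])
    (hg.abs.sub hg)
  rw [integral_add hg.abs hg, integral_add hgν.abs hgν] at hp
  rw [integral_sub hg.abs hg, integral_sub hgν.abs hgν] at hm
  have hi := abs_le.1 (abs_integral_le_integral_abs (f := g) (μ := μ))
  rw [abs_le]
  constructor <;> nlinarith

lemma one_add_pow_sub_one_le {t : ℝ} (h0 : 0 ≤ t) (h1 : t ≤ 1) (k : ℕ) :
    (1 + t) ^ k - 1 ≤ (2 ^ k - 1) * t := by
  induction k with
  | zero => simp
  | succ k ih =>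
    have h2 : (1 : ℝ) ≤ 2 ^ k := one_le_pow₀ (by norm_num)
    have h3 := mul_le_mul_of_nonneg_left h1 (mul_nonneg (sub_nonneg.2 h2) h0)
    have h4 := mul_le_mul_of_nonneg_right ih (by linarith : 0 ≤ 1 + t)
    rw [pow_succ, pow_succ]
    linarith

lemma comap_graphMap_zero :
    (μH[(d : ℝ)] : Measure (EuclideanSpace ℝ (Fin (d + m)))).comap (graphMap 0 0) =
      (μH[(d : ℝ)] : Measure (EuclideanSpace ℝ (Fin d))) := by
  refine le_antisymm ((comap_graphMap_le 0 0).trans_eq ?_) (hausdorffMeasure_le_comap_graphMap 0 0)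
  simp [matNorm]

lemma abs_integral_le_of_abs_le_on_closedBall {g : EuclideanSpace ℝ (Fin d) → ℝ}
    {p : EuclideanSpace ℝ (Fin d)} {r M : ℝ} (hr : 0 ≤ r)
    (hsupp : ∀ x ∉ closedBall p r, g x = 0) (hM : ∀ x ∈ closedBall p r, |g x| ≤ M) :
    |∫ x, g x ∂μH[(d : ℝ)]| ≤
      M * (r ^ d * (μH[(d : ℝ)]).real (closedBall (0 : EuclideanSpace ℝ (Fin d)) 1)) := by
  rw [← setIntegral_eq_integral_of_forall_compl_eq_zero hsupp,
    ← hausdorffMeasure_closedBall_real p hr]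
  rw [← Real.norm_eq_abs]
  exact norm_setIntegral_le_of_norm_le_const measure_closedBall_lt_top hM

lemma abs_sub_setIntegral_graphPlane_le (hk : 0 < d + m)
    {x₀ : EuclideanSpace ℝ (Fin (d + m))} {r c₁ c₂ : ℝ} (hr : 0 < r)
    (hx₀ : x₀ ∈ ball (0 : EuclideanSpace ℝ (Fin (d + m))) (r / 2))
    {f : EuclideanSpace ℝ (Fin (d + m)) → ℝ} (hf : f ∈ LipIn x₀ r)
    (ha : matNorm a ≤ 1) (hc₂ : 0 ≤ c₂) (hc : c₂ ≤ c₁) :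
    |c₁ * ∫ y in graphPlane d m 0 0, f y ∂μH[(d : ℝ)] -
        c₂ * ∫ y in graphPlane d m a b, f y ∂μH[(d : ℝ)]| ≤
      (c₁ * (2 * r * matNorm a + vecNorm b) + (c₁ - c₂) * (3 * r) +
        c₂ * ((2 ^ d - 1) * matNorm a) * (3 * r)) *
        (r ^ d * (μH[(d : ℝ)]).real (closedBall (0 : EuclideanSpace ℝ (Fin d)) 1)) := by
  have hA := matNorm_nonneg a
  set V := r ^ d * (μH[(d : ℝ)]).real (closedBall (0 : EuclideanSpace ℝ (Fin d)) 1)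
  have hV : 0 ≤ V := by positivity
  have hsupp (a' : Fin d → Fin m → ℝ) (b' : Fin m → ℝ) (x : EuclideanSpace ℝ (Fin d))
      (hx : x ∉ closedBall (projFirst x₀) r) : f (graphMap a' b' x) = 0 := by
    refine hf.2 _ fun h => hx ?_
    have := dist_projFirst_le (graphMap a' b' x) x₀
    rw [projFirst_graphMap] at this
    exact this.trans h
  have hint (a' : Fin d → Fin m → ℝ) (b' : Fin m → ℝ) :
      Integrable (fun x => f (graphMap a' b' x)) μH[(d : ℝ)] :=
    (hf.1.continuous.comp (lipschitzWith_graphMap a' b').continuous).integrable_of_hasCompactSupport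
      (.intro (isCompact_closedBall (projFirst x₀) r) (hsupp a' b'))
  rw [setIntegral_graphPlane, setIntegral_graphPlane, comap_graphMap_zero]
  have h1 := abs_integral_le_of_abs_le_on_closedBall (p := projFirst x₀) (r := r)
    (g := fun x => f (graphMap 0 0 x) - f (graphMap a b x)) (M := 2 * r * matNorm a + vecNorm b)
    hr.le (fun x hx => by simp only [hsupp _ _ x hx, sub_zero]) (fun x hx => by
      have hnorm : ‖x‖ ≤ 2 * r := by
        have h0 : projFirst (0 : EuclideanSpace ℝ (Fin (d + m))) = 0 := rfl
        have := dist_projFirst_le x₀ 0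
        rw [h0] at this
        rw [mem_ball] at hx₀
        rw [mem_closedBall] at hx
        rw [← dist_zero_right]
        linarith [dist_triangle x (projFirst x₀) 0]
      have := hf.1.dist_le_mul (graphMap 0 0 x) (graphMap a b x)
      rw [NNReal.coe_one, one_mul, Real.dist_eq] at this
      refine this.trans ((dist_graphMap_zero_le a b x).trans ?_)
      rw [mul_comm]
      gcongr)
  rw [integral_sub (hint _ _) (hint _ _)] at h1
  have h2 := abs_integral_le_of_abs_le_on_closedBall (p := projFirst x₀) (r := r)
    (g := fun x => |f (graphMap a b x)|) (M := 3 * r) hr.le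
    (fun x hx => by rw [hsupp _ _ x hx, abs_zero])
    (fun x _ => by rw [abs_abs]; exact abs_le_of_mem_LipIn hk hr hf _)
  have h2' := (le_abs_self _).trans h2
  have h3 := abs_integral_sub_integral_le (one_le_pow₀ (by linarith))
    (hausdorffMeasure_le_comap_graphMap a b) (comap_graphMap_le a b) (hint a b)
  have h4 := (abs_integral_le_integral_abs (f := fun x => f (graphMap a b x))).trans h2'
  have h5 := h3.trans (mul_le_mul (one_add_pow_sub_one_le hA ha d) h2'
    (integral_nonneg fun x => abs_nonneg _)
    (mul_nonneg (sub_nonneg.2 (one_le_pow₀ (by norm_num))) hA))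
  set I₀ := ∫ x, f (graphMap 0 0 x) ∂(μH[(d : ℝ)] : Measure (EuclideanSpace ℝ (Fin d)))
  set I₁ := ∫ x, f (graphMap a b x) ∂(μH[(d : ℝ)] : Measure (EuclideanSpace ℝ (Fin d)))
  set I₂ := ∫ x, f (graphMap a b x)
    ∂(μH[(d : ℝ)] : Measure (EuclideanSpace ℝ (Fin (d + m)))).comap (graphMap a b)
  have hc₁ := hc₂.trans hc
  calc |c₁ * I₀ - c₂ * I₂|
      = |c₁ * (I₀ - I₁) + (c₁ - c₂) * I₁ - c₂ * (I₂ - I₁)| := by ring_nf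
    _ ≤ |c₁ * (I₀ - I₁)| + |(c₁ - c₂) * I₁| + |c₂ * (I₂ - I₁)| :=
      (abs_sub _ _).trans (by gcongr; exact abs_add_le _ _)
    _ = c₁ * |I₀ - I₁| + (c₁ - c₂) * |I₁| + c₂ * |I₂ - I₁| := by
      rw [abs_mul, abs_mul, abs_mul, abs_of_nonneg hc₁, abs_of_nonneg hc₂,
        abs_of_nonneg (sub_nonneg.2 hc)]
    _ ≤ c₁ * ((2 * r * matNorm a + vecNorm b) * V) + (c₁ - c₂) * (3 * r * V) +
        c₂ * ((2 ^ d - 1) * matNorm a * (3 * r * V)) := by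
      have := sub_nonneg.2 hc
      gcongr
    _ = _ := by ring

end Measures

/-- With `P₁ = ℝ^d × {0}`, `P₂ = {(x,xa+b)}`, flat measures
`μᵢ = cᵢ μ_{Pᵢ}`, `c₂ ≤ c₁`, both planes meeting `B(x₀,r/2)` and `x₀ ∈ B(0,r/2)`:
`dist_{x₀,r}(μ₁,μ₂) ≤ C [c₁(|a| + |b|/r) + (c₁ − c₂)]` with `C = C(n,d)`. -/
theorem stmt14 (d m : ℕ) (hd : 0 < d) (hm : 0 < m) :
    ∃ C > 0, ∀ (a : Fin d → Fin m → ℝ) (b : Fin m → ℝ) (c₁ c₂ : ℝ)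
      (x₀ : EuclideanSpace ℝ (Fin (d + m))) (r : ℝ)
      (μ₁ μ₂ : Measure (EuclideanSpace ℝ (Fin (d + m)))),
      0 < r → 0 < c₂ → c₂ ≤ c₁ → x₀ ∈ ball (0 : EuclideanSpace ℝ (Fin (d + m))) (r / 2) →
      (graphPlane d m 0 0 ∩ ball x₀ (r / 2)).Nonempty →
      (graphPlane d m a b ∩ ball x₀ (r / 2)).Nonempty →
      μ₁ = ENNReal.ofReal c₁ • (μH[(d : ℝ)]).restrict (graphPlane d m 0 0) →
      μ₂ = ENNReal.ofReal c₂ • (μH[(d : ℝ)]).restrict (graphPlane d m a b) →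
      wdist d x₀ r μ₁ μ₂ ≤ C * (c₁ * (matNorm a + vecNorm b / r) + (c₁ - c₂)) := by
  set ω := (μH[(d : ℝ)]).real (closedBall (0 : EuclideanSpace ℝ (Fin d)) 1) with hω
  have hω0 : 0 ≤ ω := measureReal_nonneg
  refine ⟨ω * (5 + 6 * 2 ^ d) + 1, by positivity, ?_⟩
  rintro a b c₁ c₂ x₀ r _ _ hr hc₂ hc hx₀ - - rfl rfl
  have hc₁ : 0 < c₁ := hc₂.trans_le hc
  have hA := matNorm_nonneg a
  have hB := vecNorm_nonneg b
  have hX : 0 ≤ c₁ * (matNorm a + vecNorm b / r) + (c₁ - c₂) :=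
    add_nonneg (by positivity) (sub_nonneg.2 hc)
  have key (f : EuclideanSpace ℝ (Fin (d + m)) → ℝ) (hf : f ∈ LipIn x₀ r) :
      |c₁ * ∫ y in graphPlane d m 0 0, f y ∂μH[(d : ℝ)] -
          c₂ * ∫ y in graphPlane d m a b, f y ∂μH[(d : ℝ)]| ≤
        r ^ (d + 1) * ((ω * (5 + 6 * 2 ^ d)) *
          (c₁ * (matNorm a + vecNorm b / r) + (c₁ - c₂))) := by
    have h2 : (1 : ℝ) ≤ 2 ^ d := one_le_pow₀ (by norm_num)
    have hBr : vecNorm b / r * r = vecNorm b := by field_simp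
    have hBr0 : 0 ≤ vecNorm b / r := by positivity
    set β := vecNorm b / r
    rcases le_total (matNorm a) 1 with ht | ht
    · refine (abs_sub_setIntegral_graphPlane_le a b (by omega) hr hx₀ hf ht hc₂.le hc).trans ?_
      rw [← hω, ← hBr]
      have e1 : 0 ≤ c₁ * matNorm a := by positivity
      have e2 : 0 ≤ c₁ * β := by positivity
      have e3 : c₂ * matNorm a ≤ c₁ * matNorm a := by gcongr
      have e4 : c₁ * (2 * matNorm a + β) + 3 * (c₁ - c₂) +
          c₂ * ((2 ^ d - 1) * matNorm a) * 3 ≤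
          (5 + 6 * 2 ^ d) * (c₁ * (matNorm a + β) + (c₁ - c₂)) := by
        have := mul_le_mul_of_nonneg_left e3 (sub_nonneg.2 h2)
        have e5 := mul_nonneg (zero_le_one.trans h2) e1
        have e6 := mul_nonneg (zero_le_one.trans h2) e2
        have e7 := mul_nonneg (zero_le_one.trans h2) (sub_nonneg.2 hc)
        nlinarith
      calc _ = (ω * r ^ d * r) * (c₁ * (2 * matNorm a + β) + 3 * (c₁ - c₂) +
          c₂ * ((2 ^ d - 1) * matNorm a) * 3) := by ring
        _ ≤ (ω * r ^ d * r) * ((5 + 6 * 2 ^ d) * (c₁ * (matNorm a + β) + (c₁ - c₂))) :=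
          mul_le_mul_of_nonneg_left e4 (by positivity)
        _ = _ := by ring
    · have i1 := abs_setIntegral_graphPlane_le (0 : Fin d → Fin m → ℝ) 0 (by omega) hr hf
      have i2 := abs_setIntegral_graphPlane_le a b (by omega) hr hf
      rw [← hω] at i1 i2
      refine (abs_sub _ _).trans ?_
      rw [abs_mul, abs_mul, abs_of_pos hc₁, abs_of_pos hc₂]
      have e1 : c₁ ≤ c₁ * (matNorm a + β) + (c₁ - c₂) := by nlinarith
      calc _ ≤ c₁ * (3 * r * ((2 * r) ^ d * ω)) + c₁ * (3 * r * ((2 * r) ^ d * ω)) := by gcongr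
        _ = (ω * r ^ d * r) * (6 * 2 ^ d * c₁) := by rw [mul_pow]; ring
        _ ≤ (ω * r ^ d * r) * ((5 + 6 * 2 ^ d) *
            (c₁ * (matNorm a + β) + (c₁ - c₂))) := by gcongr; linarith
        _ = _ := by ring
  have hsup : ⨆ f : LipIn x₀ r,
      |∫ y, f.1 y ∂(ENNReal.ofReal c₁ • (μH[(d : ℝ)]).restrict (graphPlane d m 0 0)) -
        ∫ y, f.1 y ∂(ENNReal.ofReal c₂ • (μH[(d : ℝ)]).restrict (graphPlane d m a b))| ≤
      r ^ (d + 1) * ((ω * (5 + 6 * 2 ^ d)) *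
          (c₁ * (matNorm a + vecNorm b / r) + (c₁ - c₂))) := by
    refine Real.iSup_le (fun f => ?_) (by positivity)
    rw [integral_smul_measure, integral_smul_measure, ENNReal.toReal_ofReal hc₁.le,
      ENNReal.toReal_ofReal hc₂.le, smul_eq_mul, smul_eq_mul]
    exact key f.1 f.2
  have hpow : r ^ (-(d : ℝ) - 1) * r ^ (d + 1) = 1 := by
    rw [← Real.rpow_natCast r (d + 1), ← Real.rpow_add hr]
    push_cast
    ring_nf
    simp
  calc _ ≤ r ^ (-(d : ℝ) - 1) * _ := mul_le_mul_of_nonneg_left hsup (Real.rpow_nonneg hr.le _)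
    _ = (ω * (5 + 6 * 2 ^ d)) * (c₁ * (matNorm a + vecNorm b / r) + (c₁ - c₂)) := by
      rw [← mul_assoc, hpow, one_mul]
    _ ≤ _ := by gcongr; linarith
end
end

section
/- Let μ₁ = c₁μ_{P₁}, μ₂ = c₂μ_{P₂} be flat d-measures in ℝⁿ with both P₁, P₂ intersecting B(x₀, r/2). Then for every k ∈ ℕ, dist_{x₀, 2^k r}(μ₁,μ₂) ≤ C dist_{x₀,r}(μ₁,μ₂) with C depending only on n, d (quasi-monotonicity of the normalized Wasserstein distance in the radius). -/
open MeasureTheory Metric Set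

noncomputable section

section FlatGeometry

variable {E : Type*} [NormedAddCommGroup E] [InnerProductSpace ℝ E] {d : ℕ}

/-- A linear map on Euclidean space that is bounded by `δ` on the standard basis is bounded
by `d * δ`. -/
lemma norm_apply_le_of_basis {F : Type*} [NormedAddCommGroup F] [NormedSpace ℝ F]
    (L : EuclideanSpace ℝ (Fin d) →ₗ[ℝ] F) {δ : ℝ}
    (h : ∀ i, ‖L (EuclideanSpace.basisFun (Fin d) ℝ i)‖ ≤ δ) (w : EuclideanSpace ℝ (Fin d)) :
    ‖L w‖ ≤ d * δ * ‖w‖ := by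
  have hw : w = ∑ i, w i • EuclideanSpace.basisFun (Fin d) ℝ i := by
    simpa using ((EuclideanSpace.basisFun (Fin d) ℝ).sum_repr w).symm
  have hL : L w = ∑ i, w i • L (EuclideanSpace.basisFun (Fin d) ℝ i) := by
    conv_lhs => rw [hw]
    simp only [map_sum, map_smul]
  rw [hL]
  calc ‖∑ i, w i • L (EuclideanSpace.basisFun (Fin d) ℝ i)‖
      ≤ ∑ _i : Fin d, ‖w‖ * δ := by
        refine norm_sum_le_of_le _ fun i _ => ?_
        rw [norm_smul]
        exact mul_le_mul (PiLp.norm_apply_le w i) (h i) (norm_nonneg _) (norm_nonneg _)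
    _ = d * δ * ‖w‖ := by simp; ring

/-- The linear isometry of Euclidean space onto a subspace given by an orthonormal basis. -/
def isometryOfBasis {V : Submodule ℝ E} (b : OrthonormalBasis (Fin d) ℝ V) :
    EuclideanSpace ℝ (Fin d) →ₗᵢ[ℝ] E :=
  V.subtypeₗᵢ.comp b.repr.symm.toLinearIsometry

lemma isometryOfBasis_basisFun {V : Submodule ℝ E} (b : OrthonormalBasis (Fin d) ℝ V)
    (i : Fin d) : isometryOfBasis b (EuclideanSpace.basisFun (Fin d) ℝ i) = b i := by
  simp [isometryOfBasis]

lemma range_isometryOfBasis {V : Submodule ℝ E} (b : OrthonormalBasis (Fin d) ℝ V) :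
    range (isometryOfBasis b) = V := by
  ext x
  constructor
  · rintro ⟨w, rfl⟩
    exact (b.repr.symm w).2
  · intro hx
    exact ⟨b.repr ⟨x, hx⟩, by simp [isometryOfBasis]⟩

/-- Two `d`-dimensional subspaces are parametrized by linear isometries whose difference on the
standard basis is controlled by the tilt of the first subspace against the second. -/
lemma exists_close_isometries [FiniteDimensional ℝ E] (V₁ V₂ : Submodule ℝ E)
    (h₁ : Module.finrank ℝ V₁ = d) (h₂ : Module.finrank ℝ V₂ = d) :
    ∃ ι₁ ι₂ : EuclideanSpace ℝ (Fin d) →ₗᵢ[ℝ] E, range ι₁ = V₁ ∧ range ι₂ = V₂ ∧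
      ∀ i, ‖ι₁ (EuclideanSpace.basisFun (Fin d) ℝ i) - ι₂ (EuclideanSpace.basisFun (Fin d) ℝ i)‖ ≤
        2 * ‖V₂ᗮ.starProjection (ι₁ (EuclideanSpace.basisFun (Fin d) ℝ i))‖ := by
  let A : V₁ →ₗ[ℝ] V₂ := V₂.orthogonalProjectionOnto.toLinearMap ∘ₗ V₁.subtype
  have hA : ∀ x : V₁, (A x : E) + V₂ᗮ.starProjection (x : E) = x := fun x =>
    V₂.starProjection_add_starProjection_orthogonal (x : E)
  have hsymm := A.isSymmetric_adjoint_comp_self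
  let e := hsymm.eigenvectorBasis h₁
  have horth : ∀ i j, i ≠ j → inner ℝ (A (e i)) (A (e j)) = 0 := by
    intro i j hij
    rw [← LinearMap.adjoint_inner_left, ← LinearMap.comp_apply,
      hsymm.apply_eigenvectorBasis h₁ i, inner_smul_left, e.orthonormal.2 hij, mul_zero]
  let v : Fin d → V₂ := fun i => ‖A (e i)‖⁻¹ • A (e i)
  let s : Set (Fin d) := {i | A (e i) ≠ 0}
  have hv : Orthonormal ℝ (s.domRestrict v) := by
    constructor
    · rintro ⟨i, hi⟩
      exact norm_smul_inv_norm hi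
    · rintro ⟨i, hi⟩ ⟨j, hj⟩ hij
      have : i ≠ j := fun h => hij (Subtype.ext h)
      change inner ℝ (v i) (v j) = 0
      simp only [v, inner_smul_left, inner_smul_right, horth i j this, mul_zero]
  obtain ⟨u, hu⟩ := hv.exists_orthonormalBasis_extension_of_card_eq (by simpa using h₂)
  refine ⟨isometryOfBasis e, isometryOfBasis u, range_isometryOfBasis e, range_isometryOfBasis u,
    fun i => ?_⟩
  rw [isometryOfBasis_basisFun, isometryOfBasis_basisFun]
  have he : ‖(e i : E)‖ = 1 := e.orthonormal.1 i
  have hui : ‖(u i : E)‖ = 1 := u.orthonormal.1 i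
  have hdec := hA (e i)
  set q := V₂ᗮ.starProjection (e i : E)
  by_cases hi : A (e i) = 0
  · rw [hi] at hdec
    simp only [ZeroMemClass.coe_zero, zero_add] at hdec
    rw [hdec, he]
    calc _ ≤ ‖(e i : E)‖ + ‖(u i : E)‖ := norm_sub_le _ _
      _ = _ := by rw [he, hui]; norm_num
  · have hui' := hu i hi
    set t := ‖A (e i)‖
    have ht : t ≠ 0 := norm_ne_zero_iff.2 hi
    have hAu : (A (e i) : E) = t • (u i : E) := by
      rw [hui']
      simp only [v, SetLike.val_smul, smul_smul]
      rw [mul_inv_cancel₀ ht, one_smul]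
    have ht1 : t ≤ 1 := by
      have := V₂.norm_starProjection_apply_le (e i : E)
      rwa [he] at this
    have ht2 : 1 - t ≤ ‖q‖ := by
      have : ‖(e i : E)‖ ≤ t + ‖q‖ := by
        rw [← hdec]
        exact norm_add_le _ _
      rw [he] at this
      linarith
    have : (e i : E) - u i = q - (1 - t) • (u i : E) := by
      rw [← hdec, hAu, sub_smul, one_smul]
      abel
    rw [this]
    calc _ ≤ ‖q‖ + ‖(1 - t) • (u i : E)‖ := norm_sub_le _ _
      _ = ‖q‖ + (1 - t) := by
        rw [norm_smul, hui, mul_one, Real.norm_eq_abs, abs_of_nonneg (by linarith)]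
      _ ≤ _ := by linarith

/-- Somewhere in the ball of radius `ρ`, the affine map `w ↦ a + T w` is at least as large as its
value at the centre and as its linear part along a given unit vector, scaled by `ρ`. -/
lemma exists_large_value {F : Type*} [NormedAddCommGroup F] [NormedSpace ℝ F]
    {G : Type*} [NormedAddCommGroup G] [NormedSpace ℝ G] (T : G →ₗ[ℝ] F) (a : F) {e : G}
    (he : ‖e‖ = 1) {ρ : ℝ} (hρ : 0 ≤ ρ) :
    ∃ z : G, ‖z‖ ≤ ρ ∧ ‖a‖ ≤ ‖a + T z‖ ∧ ρ * ‖T e‖ ≤ ‖a + T z‖ := by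
  have key : ∀ x y : F, ‖x‖ ≤ max ‖x + y‖ ‖x - y‖ := by
    intro x y
    have h1 : ‖(x + y) + (x - y)‖ ≤ ‖x + y‖ + ‖x - y‖ := norm_add_le _ _
    have h2 : (x + y) + (x - y) = (2 : ℝ) • x := by rw [two_smul]; abel
    rw [h2, norm_smul] at h1
    norm_num at h1
    rcases le_total ‖x + y‖ ‖x - y‖ with h | h
    · exact le_max_of_le_right (by linarith)
    · exact le_max_of_le_left (by linarith)
  have k1 := key a (T (ρ • e))
  have k2 := key (T (ρ • e)) a
  rw [add_comm, norm_sub_rev] at k2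
  have k3 : ‖T (ρ • e)‖ = ρ * ‖T e‖ := by
    rw [map_smul, norm_smul, Real.norm_of_nonneg hρ]
  have k4 : ‖ρ • e‖ = ρ := by rw [norm_smul, he, Real.norm_of_nonneg hρ, mul_one]
  rw [k3] at k2
  rcases le_total ‖a + T (ρ • e)‖ ‖a - T (ρ • e)‖ with h | h
  · rw [max_eq_right h] at k1 k2
    refine ⟨-(ρ • e), by rw [norm_neg, k4], ?_, ?_⟩ <;> rwa [map_neg, ← sub_eq_add_neg]
  · rw [max_eq_left h] at k1 k2
    exact ⟨ρ • e, k4.le, k1, k2⟩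

end FlatGeometry

section FlatIntegrals

variable {E : Type*} [NormedAddCommGroup E] [InnerProductSpace ℝ E] {d : ℕ}

/-- Integration against a flat measure, in isometric coordinates. -/
lemma integral_flat [MeasurableSpace E] [BorelSpace E]
    (P : AffineSubspace ℝ E) {p : E} (hp : p ∈ P)
    (ι : EuclideanSpace ℝ (Fin d) →ₗᵢ[ℝ] E) (hι : range ι = P.direction) {c : ℝ} (hc : 0 ≤ c)
    (f : E → ℝ) :
    ∫ y, f y ∂(ENNReal.ofReal c • (μH[(d : ℝ)]).restrict (P : Set E)) =
      c * ∫ w, f (p + ι w) ∂(μH[(d : ℝ)] : Measure (EuclideanSpace ℝ (Fin d))) := by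
  have hiso : Isometry fun w => p + ι w := (isometry_add_left p).comp ι.isometry
  have hrange : range (fun w => p + ι w) = (P : Set E) := by
    ext x
    constructor
    · rintro ⟨w, rfl⟩
      have : ι w ∈ P.direction := by
        rw [← SetLike.mem_coe, ← hι]
        exact mem_range_self w
      have := AffineSubspace.vadd_mem_of_mem_direction this hp
      rwa [vadd_eq_add, add_comm] at this
    · intro hx
      have : x -ᵥ p ∈ (P.direction : Set E) := AffineSubspace.vsub_mem_direction hx hp
      rw [← hι] at this
      obtain ⟨w, hw⟩ := this
      exact ⟨w, by simp [hw]⟩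
  rw [integral_smul_measure, ENNReal.toReal_ofReal hc, ← hrange,
    ← hiso.map_hausdorffMeasure (Or.inl (by positivity)),
    hiso.isClosedEmbedding.measurableEmbedding.integral_map, smul_eq_mul]

instance isAddHaarMeasure_hausdorffMeasure_euclideanSpace :
    (μH[(d : ℝ)] : Measure (EuclideanSpace ℝ (Fin d))).IsAddHaarMeasure := by
  simpa using MeasureTheory.isAddHaarMeasure_hausdorffMeasure (E := EuclideanSpace ℝ (Fin d))

/-- The Hausdorff measure of the unit ball of `ℝᵈ`. -/
def unitBallVolume (d : ℕ) : ℝ :=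
  (μH[(d : ℝ)] : Measure (EuclideanSpace ℝ (Fin d))).real (ball 0 1)

lemma unitBallVolume_pos (d : ℕ) : 0 < unitBallVolume d :=
  ENNReal.toReal_pos (measure_ball_pos _ _ one_pos).ne' measure_ball_lt_top.ne

lemma real_closedBall_eq (z : EuclideanSpace ℝ (Fin d)) {s : ℝ} (hs : 0 ≤ s) :
    (μH[(d : ℝ)] : Measure (EuclideanSpace ℝ (Fin d))).real (closedBall z s) =
      s ^ d * unitBallVolume d := by
  rw [Measure.real, Measure.addHaar_closedBall _ z hs, ENNReal.toReal_mul,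
    ENNReal.toReal_ofReal (by positivity), finrank_euclideanSpace_fin]
  rfl

lemma le_integral_of_le_on_closedBall {F : EuclideanSpace ℝ (Fin d) → ℝ}
    (hF : Integrable F (μH[(d : ℝ)])) (h0 : ∀ w, 0 ≤ F w) {z : EuclideanSpace ℝ (Fin d)}
    {s M : ℝ} (hs : 0 ≤ s) (hM : ∀ w ∈ closedBall z s, M ≤ F w) :
    M * (s ^ d * unitBallVolume d) ≤ ∫ w, F w ∂(μH[(d : ℝ)]) := by
  rw [← real_closedBall_eq z hs, mul_comm, ← smul_eq_mul]
  refine (setIntegral_ge_of_const_le measurableSet_closedBall measure_closedBall_lt_top.ne hM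
    hF.integrableOn).trans ?_
  exact setIntegral_le_integral hF (Filter.Eventually.of_forall h0)

lemma abs_integral_le_of_closedBall {F : EuclideanSpace ℝ (Fin d) → ℝ}
    {s M : ℝ} (hs : 0 ≤ s) (h0 : ∀ w ∉ closedBall 0 s, F w = 0)
    (hM : ∀ w ∈ closedBall 0 s, |F w| ≤ M) :
    |∫ w, F w ∂(μH[(d : ℝ)])| ≤ M * (s ^ d * unitBallVolume d) := by
  rw [← real_closedBall_eq 0 hs, ← setIntegral_eq_integral_of_forall_compl_eq_zero h0]
  exact norm_setIntegral_le_of_norm_le_const (f := F) measure_closedBall_lt_top hM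

lemma LipIn.abs_le [Nontrivial E] {x : E} {R : ℝ} (hR : 0 < R) {f : E → ℝ} (hf : f ∈ LipIn x R)
    (y : E) : |f y| ≤ 3 * R := by
  by_cases hy : y ∈ closedBall x R
  · obtain ⟨u, hu⟩ := exists_norm_eq E (c := 2 * R) (by positivity)
    have h0 : f (x + u) = 0 := hf.2 _ (by simp [hu]; linarith)
    have h1 := hf.1.dist_le_mul y (x + u)
    rw [Real.dist_eq, h0, sub_zero] at h1
    have h2 : dist y (x + u) ≤ dist y x + dist x (x + u) := dist_triangle _ _ _
    rw [dist_self_add_right, hu] at h2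
    rw [mem_closedBall] at hy
    simp only [NNReal.coe_one, one_mul] at h1
    linarith
  · rw [hf.2 y hy, abs_zero]
    positivity

lemma LipIn.comp_eq_zero {x p : E} {R s : ℝ} {f : E → ℝ} (hf : f ∈ LipIn x R)
    (ι : EuclideanSpace ℝ (Fin d) →ₗᵢ[ℝ] E) (hs : R + ‖p - x‖ ≤ s) :
    ∀ w ∉ closedBall 0 s, f (p + ι w) = 0 := by
  intro w hw
  apply hf.2
  rw [mem_closedBall, dist_eq_norm]
  rw [mem_closedBall_zero_iff] at hw
  intro h
  apply hw
  have : ι w = (p + ι w - x) - (p - x) := by abel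
  rw [← ι.norm_map, this]
  exact (norm_sub_le _ _).trans (by linarith)

lemma LipIn.integrable_comp {x p : E} {R : ℝ} {f : E → ℝ} (hf : f ∈ LipIn x R)
    (ι : EuclideanSpace ℝ (Fin d) →ₗᵢ[ℝ] E) :
    Integrable (fun w => f (p + ι w)) (μH[(d : ℝ)]) := by
  refine Continuous.integrable_of_hasCompactSupport ?_ ?_
  · exact hf.1.continuous.comp (continuous_const.add ι.continuous)
  · exact HasCompactSupport.intro (isCompact_closedBall 0 (R + ‖p - x‖))
      (LipIn.comp_eq_zero hf ι le_rfl)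

/-- The integrals of a Lipschitz function along two nearby isometric planes are close. -/
lemma LipIn.abs_integral_sub_le {x p₁ p₂ : E} {R δ : ℝ} (hR : 0 < R) {f : E → ℝ}
    (hf : f ∈ LipIn x R) (ι₁ ι₂ : EuclideanSpace ℝ (Fin d) →ₗᵢ[ℝ] E)
    (hp₁ : ‖p₁ - x‖ ≤ 2 * R) (hp₂ : ‖p₂ - x‖ ≤ 2 * R) (hδ : 0 ≤ δ)
    (hι : ∀ w, ‖ι₁ w - ι₂ w‖ ≤ δ * ‖w‖) :
    |∫ w, f (p₁ + ι₁ w) ∂(μH[(d : ℝ)]) - ∫ w, f (p₂ + ι₂ w) ∂(μH[(d : ℝ)])| ≤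
      (‖p₁ - p₂‖ + 3 * δ * R) * ((3 * R) ^ d * unitBallVolume d) := by
  rw [← integral_sub (LipIn.integrable_comp hf ι₁) (LipIn.integrable_comp hf ι₂)]
  refine abs_integral_le_of_closedBall (by positivity) (fun w hw => ?_) fun w hw => ?_
  · rw [LipIn.comp_eq_zero hf ι₁ (by linarith) w hw, LipIn.comp_eq_zero hf ι₂ (by linarith) w hw, sub_zero]
  · have h1 := hf.1.dist_le_mul (p₁ + ι₁ w) (p₂ + ι₂ w)
    rw [Real.dist_eq, dist_eq_norm] at h1
    simp only [NNReal.coe_one, one_mul] at h1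
    have h2 : p₁ + ι₁ w - (p₂ + ι₂ w) = (p₁ - p₂) + (ι₁ w - ι₂ w) := by abel
    rw [h2] at h1
    rw [mem_closedBall_zero_iff] at hw
    calc _ ≤ _ := h1
      _ ≤ ‖p₁ - p₂‖ + ‖ι₁ w - ι₂ w‖ := norm_add_le _ _
      _ ≤ ‖p₁ - p₂‖ + δ * ‖w‖ := by gcongr; exact hι w
      _ ≤ ‖p₁ - p₂‖ + δ * (3 * R) := by gcongr
      _ = _ := by ring

/-- Upper bound for the weighted difference of the integrals along two planes. -/
lemma LipIn.abs_weighted_sub_le [Nontrivial E] {x p₁ p₂ : E} {R δ c₁ c₂ : ℝ} (hR : 0 < R)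
    {f : E → ℝ} (hf : f ∈ LipIn x R) (ι₁ ι₂ : EuclideanSpace ℝ (Fin d) →ₗᵢ[ℝ] E)
    (hp₁ : ‖p₁ - x‖ ≤ 2 * R) (hp₂ : ‖p₂ - x‖ ≤ 2 * R) (hδ : 0 ≤ δ)
    (hι : ∀ w, ‖ι₁ w - ι₂ w‖ ≤ δ * ‖w‖) (hc₁ : 0 ≤ c₁) :
    |c₁ * ∫ w, f (p₁ + ι₁ w) ∂(μH[(d : ℝ)]) - c₂ * ∫ w, f (p₂ + ι₂ w) ∂(μH[(d : ℝ)])| ≤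
      (c₁ * (‖p₁ - p₂‖ + 3 * δ * R) + |c₁ - c₂| * (3 * R)) *
        ((3 * R) ^ d * unitBallVolume d) := by
  have h1 := LipIn.abs_integral_sub_le hR hf ι₁ ι₂ hp₁ hp₂ hδ hι
  have h2 : |∫ w, f (p₂ + ι₂ w) ∂(μH[(d : ℝ)])| ≤
      3 * R * ((3 * R) ^ d * unitBallVolume d) :=
    abs_integral_le_of_closedBall (by positivity) (LipIn.comp_eq_zero hf ι₂ (by linarith))
      fun w _ => LipIn.abs_le hR hf _
  set I₁ := ∫ w, f (p₁ + ι₁ w) ∂(μH[(d : ℝ)])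
  set I₂ := ∫ w, f (p₂ + ι₂ w) ∂(μH[(d : ℝ)])
  have h3 : c₁ * I₁ - c₂ * I₂ = c₁ * (I₁ - I₂) + (c₁ - c₂) * I₂ := by ring
  rw [h3]
  calc _ ≤ |c₁ * (I₁ - I₂)| + |(c₁ - c₂) * I₂| := abs_add_le _ _
    _ = c₁ * |I₁ - I₂| + |c₁ - c₂| * |I₂| := by rw [abs_mul, abs_mul, abs_of_nonneg hc₁]
    _ ≤ c₁ * ((‖p₁ - p₂‖ + 3 * δ * R) * ((3 * R) ^ d * unitBallVolume d)) +
        |c₁ - c₂| * (3 * R * ((3 * R) ^ d * unitBallVolume d)) := by gcongr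
    _ = _ := by ring

end FlatIntegrals

section NormalizedDistance

variable {E : Type*} [NormedAddCommGroup E] {d : ℕ}

lemma lipschitzWith_radius_sub (x : E) (r : ℝ) : LipschitzWith 1 fun y => r - ‖y - x‖ := by
  refine LipschitzWith.of_dist_le_mul fun y z => ?_
  rw [Real.dist_eq, NNReal.coe_one, one_mul, dist_eq_norm]
  have h1 : r - ‖y - x‖ - (r - ‖z - x‖) = -(‖y - x‖ - ‖z - x‖) := by ring
  have h2 : y - z = (y - x) - (z - x) := by abel
  rw [h1, abs_neg, h2]
  exact abs_norm_sub_norm_le _ _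

lemma cutoff_mem_LipIn (x : E) (r : ℝ) : (fun y => max (r - ‖y - x‖) 0) ∈ LipIn x r := by
  refine ⟨(lipschitzWith_radius_sub x r).max_const 0, fun y hy => ?_⟩
  rw [mem_closedBall, dist_eq_norm] at hy
  exact max_eq_right (by linarith)

/-- Passing from bounds on test integrals to the normalized distances. -/
lemma wdist_le_of_bound [MeasurableSpace E] {x : E} {r t C : ℝ} (hr : 0 < r)
    (ht : 0 < t) (μ ν : Measure E)
    (hbdd : BddAbove (range fun f : LipIn x r => |∫ y, f.1 y ∂μ - ∫ y, f.1 y ∂ν|))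
    (h : ∀ S, (∀ f ∈ LipIn x r, |∫ y, f y ∂μ - ∫ y, f y ∂ν| ≤ S) →
      ∀ f ∈ LipIn x (t * r), |∫ y, f y ∂μ - ∫ y, f y ∂ν| ≤ t ^ (d + 1) * (C * S)) :
    wdist d x (t * r) μ ν ≤ C * wdist d x r μ ν := by
  unfold wdist
  set S := ⨆ f : LipIn x r, |∫ y, f.1 y ∂μ - ∫ y, f.1 y ∂ν|
  have hS : ∀ f ∈ LipIn x r, |∫ y, f y ∂μ - ∫ y, f y ∂ν| ≤ S :=
    fun f hf => le_ciSup hbdd (⟨f, hf⟩ : LipIn x r)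
  have hne : Nonempty (LipIn x (t * r)) := ⟨⟨_, cutoff_mem_LipIn x (t * r)⟩⟩
  have hsup : ⨆ f : LipIn x (t * r), |∫ y, f.1 y ∂μ - ∫ y, f.1 y ∂ν| ≤ t ^ (d + 1) * (C * S) :=
    ciSup_le fun f => h S hS f.1 f.2
  have hpow : t ^ (-(d : ℝ) - 1) * t ^ (d + 1) = 1 := by
    rw [← Real.rpow_natCast, ← Real.rpow_add ht]
    push_cast
    rw [show -(d : ℝ) - 1 + (d + 1) = 0 by ring, Real.rpow_zero]
  calc _ ≤ (t * r) ^ (-(d : ℝ) - 1) * (t ^ (d + 1) * (C * S)) := by gcongr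
    _ = (t ^ (-(d : ℝ) - 1) * t ^ (d + 1)) * (C * (r ^ (-(d : ℝ) - 1) * S)) := by
      rw [Real.mul_rpow ht.le hr.le]; ring
    _ = _ := by rw [hpow, one_mul]

end NormalizedDistance

section LowerBounds

variable {E : Type*} [NormedAddCommGroup E] [InnerProductSpace ℝ E] {d : ℕ}

lemma tilt_cutoff_mem_LipIn (x p : E) (r : ℝ) (Q : E →ₗ[ℝ] E) (hQ : ∀ y, ‖Q y‖ ≤ ‖y‖) :
    (fun y => max (min ‖Q (y - p)‖ (r - ‖y - x‖)) 0) ∈ LipIn x r := by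
  have hL : LipschitzWith 1 fun y => ‖Q (y - p)‖ := by
    refine LipschitzWith.of_dist_le_mul fun y z => ?_
    rw [Real.dist_eq, NNReal.coe_one, one_mul, dist_eq_norm]
    refine (abs_norm_sub_norm_le _ _).trans ?_
    rw [← map_sub, sub_sub_sub_cancel_right]
    exact hQ _
  refine ⟨?_, fun y hy => ?_⟩
  · simpa using (hL.min (lipschitzWith_radius_sub x r)).max_const 0
  · rw [mem_closedBall, dist_eq_norm] at hy
    exact max_eq_right ((min_le_right _ _).trans (by linarith))

/-- Testing with the truncated distance to the second plane bounds the offset and the tilt. -/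
lemma offset_tilt_le (hd : 0 < d) {x p₁ p₂ : E} {r c₁ c₂ S : ℝ} (hr : 0 < r) (hc₁ : 0 ≤ c₁)
    (ι₁ ι₂ : EuclideanSpace ℝ (Fin d) →ₗᵢ[ℝ] E) (Q : E →ₗ[ℝ] E) (hQ : ∀ y, ‖Q y‖ ≤ ‖y‖)
    (hQ₂ : ∀ w, Q (ι₂ w) = 0) (hQa : Q (p₁ - p₂) = p₁ - p₂) (ha : ‖p₁ - p₂‖ ≤ r)
    (hp₁ : ‖p₁ - x‖ ≤ r / 2) {e : EuclideanSpace ℝ (Fin d)} (he : ‖e‖ = 1)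
    (hε : ∀ w, ‖Q (ι₁ w)‖ ≤ d * ‖Q (ι₁ e)‖ * ‖w‖)
    (hS : ∀ f ∈ LipIn x r, |c₁ * ∫ w, f (p₁ + ι₁ w) ∂(μH[(d : ℝ)]) -
      c₂ * ∫ w, f (p₂ + ι₂ w) ∂(μH[(d : ℝ)])| ≤ S) :
    c₁ * (‖p₁ - p₂‖ + r * ‖Q (ι₁ e)‖) * (r ^ d * unitBallVolume d) ≤
      45 * (16 * d) ^ d * S := by
  have hd' : (0 : ℝ) < d := by exact_mod_cast hd
  have hd1 : (1 : ℝ) ≤ d := by exact_mod_cast hd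
  have hω := unitBallVolume_pos d
  obtain ⟨z, hz, hM1, hM2⟩ := exists_large_value (Q ∘ₗ ι₁.toLinearMap) (p₁ - p₂) he
    (ρ := r / 8) (by positivity)
  simp only [LinearMap.comp_apply, LinearIsometry.coe_toLinearMap] at hM1 hM2
  set M := ‖p₁ - p₂ + Q (ι₁ z)‖ with hMdef
  set ε := ‖Q (ι₁ e)‖
  have hMr : M ≤ 9 / 8 * r := by
    have h1 : ‖Q (ι₁ z)‖ ≤ ‖z‖ := (hQ _).trans (ι₁.norm_map z).le
    have := norm_add_le (p₁ - p₂) (Q (ι₁ z))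
    linarith
  have hf := tilt_cutoff_mem_LipIn x p₂ r Q hQ
  have hSf := hS _ hf
  set f : E → ℝ := fun y => max (min ‖Q (y - p₂)‖ (r - ‖y - x‖)) 0
  have hf2 : ∀ w, f (p₂ + ι₂ w) = 0 := by
    intro w
    simp only [f, add_sub_cancel_left, hQ₂, norm_zero]
    exact max_eq_right (min_le_left _ _)
  have hf1 : ∀ w ∈ closedBall z (r / (16 * d)), M / 5 ≤ f (p₁ + ι₁ w) := by
    intro w hw
    rw [mem_closedBall, dist_eq_norm] at hw
    have h1 : Q (p₁ + ι₁ w - p₂) = (p₁ - p₂ + Q (ι₁ z)) + Q (ι₁ (w - z)) := by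
      have : p₁ + ι₁ w - p₂ = (p₁ - p₂) + ι₁ w := by abel
      rw [this, map_add, hQa, map_sub, map_sub]
      abel
    have h2 : ‖Q (ι₁ (w - z))‖ ≤ r * ε / 16 := by
      calc _ ≤ d * ε * ‖w - z‖ := hε _
        _ ≤ d * ε * (r / (16 * d)) := by gcongr
        _ = _ := by field_simp
    have h3 : M / 5 ≤ ‖Q (p₁ + ι₁ w - p₂)‖ := by
      rw [h1]
      have := norm_sub_le_norm_add (p₁ - p₂ + Q (ι₁ z)) (Q (ι₁ (w - z)))
      have hM0 : 0 ≤ M := norm_nonneg _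
      linarith
    have h4 : r / (16 * d) ≤ r / 16 := by
      apply div_le_div_of_nonneg_left hr.le (by norm_num)
      linarith
    have h5 : ‖p₁ + ι₁ w - x‖ ≤ 3 / 4 * r := by
      have e1 : p₁ + ι₁ w - x = (p₁ - x) + (ι₁ (w - z) + ι₁ z) := by
        rw [map_sub]; abel
      rw [e1]
      have := norm_add_le (p₁ - x) (ι₁ (w - z) + ι₁ z)
      have := norm_add_le (ι₁ (w - z)) (ι₁ z)
      rw [ι₁.norm_map, ι₁.norm_map] at this
      linarith
    exact le_max_of_le_left (le_min h3 (by linarith))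
  have hint := le_integral_of_le_on_closedBall (LipIn.integrable_comp hf ι₁)
    (fun w => le_max_right _ _) (by positivity) hf1
  change |c₁ * ∫ w, f (p₁ + ι₁ w) ∂(μH[(d : ℝ)]) -
    c₂ * ∫ w, f (p₂ + ι₂ w) ∂(μH[(d : ℝ)])| ≤ S at hSf
  simp only [hf2, integral_zero, mul_zero, sub_zero] at hSf
  have h6 : c₁ * (M / 5 * ((r / (16 * d)) ^ d * unitBallVolume d)) ≤ S :=
    (mul_le_mul_of_nonneg_left hint hc₁).trans ((le_abs_self _).trans hSf)
  calc c₁ * (‖p₁ - p₂‖ + r * ε) * (r ^ d * unitBallVolume d)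
      ≤ c₁ * (9 * M) * (r ^ d * unitBallVolume d) := by
        gcongr
        linarith
    _ = 45 * (16 * d) ^ d * (c₁ * (M / 5 * ((r / (16 * d)) ^ d * unitBallVolume d))) := by
        rw [div_pow]
        field_simp
        ring
    _ ≤ _ := by gcongr

/-- Testing with a radial cutoff bounds the difference of the densities. -/
lemma density_sub_le {x p₁ p₂ : E} {r c₁ c₂ S δ : ℝ} (hr : 0 < r) (hc₁ : 0 ≤ c₁)
    (ι₁ ι₂ : EuclideanSpace ℝ (Fin d) →ₗᵢ[ℝ] E)
    (hp₁ : ‖p₁ - x‖ ≤ 2 * r) (hp₂ : ‖p₂ - x‖ ≤ 2 * r) (hδ : 0 ≤ δ)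
    (hι : ∀ w, ‖ι₁ w - ι₂ w‖ ≤ δ * ‖w‖) {z : EuclideanSpace ℝ (Fin d)}
    (hz : ‖p₂ + ι₂ z - x‖ ≤ r / 2)
    (hS : ∀ f ∈ LipIn x r, |c₁ * ∫ w, f (p₁ + ι₁ w) ∂(μH[(d : ℝ)]) -
      c₂ * ∫ w, f (p₂ + ι₂ w) ∂(μH[(d : ℝ)])| ≤ S) :
    |c₁ - c₂| * r * (r ^ d * unitBallVolume d) ≤
      4 ^ (d + 1) * (S + 3 ^ d * (c₁ * (‖p₁ - p₂‖ + 3 * δ * r) * (r ^ d * unitBallVolume d))) := by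
  have hf := cutoff_mem_LipIn x r
  have hSf := hS _ hf
  have hdiff := LipIn.abs_integral_sub_le hr hf ι₁ ι₂ hp₁ hp₂ hδ hι
  have hlow : ∀ w ∈ closedBall z (r / 4), r / 4 ≤ max (r - ‖p₂ + ι₂ w - x‖) 0 := by
    intro w hw
    rw [mem_closedBall, dist_eq_norm] at hw
    have e1 : p₂ + ι₂ w - x = (p₂ + ι₂ z - x) + ι₂ (w - z) := by rw [map_sub]; abel
    have := norm_add_le (p₂ + ι₂ z - x) (ι₂ (w - z))
    rw [← e1, ι₂.norm_map] at this
    exact le_max_of_le_left (by linarith)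
  have hint := le_integral_of_le_on_closedBall (LipIn.integrable_comp hf ι₂)
    (fun w => le_max_right _ _) (by positivity) hlow
  set I₁ := ∫ w, max (r - ‖p₁ + ι₁ w - x‖) 0 ∂(μH[(d : ℝ)])
  set I₂ := ∫ w, max (r - ‖p₂ + ι₂ w - x‖) 0 ∂(μH[(d : ℝ)])
  have hω := unitBallVolume_pos d
  have h1 : |c₁ - c₂| * I₂ ≤ S + c₁ * |I₁ - I₂| := by
    have h2 : (c₁ - c₂) * I₂ = (c₁ * I₁ - c₂ * I₂) - c₁ * (I₁ - I₂) := by ring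
    have h3 : 0 ≤ I₂ := le_trans (by positivity) hint
    calc |c₁ - c₂| * I₂ = |(c₁ - c₂) * I₂| := by rw [abs_mul, abs_of_nonneg h3]
      _ ≤ |c₁ * I₁ - c₂ * I₂| + |c₁ * (I₁ - I₂)| := by rw [h2]; exact abs_sub _ _
      _ ≤ S + c₁ * |I₁ - I₂| := by rw [abs_mul c₁, abs_of_nonneg hc₁]; gcongr
  calc |c₁ - c₂| * r * (r ^ d * unitBallVolume d)
      = 4 ^ (d + 1) * (|c₁ - c₂| * (r / 4 * ((r / 4) ^ d * unitBallVolume d))) := by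
        rw [div_pow]
        field_simp
        ring
    _ ≤ 4 ^ (d + 1) * (|c₁ - c₂| * I₂) := by gcongr
    _ ≤ 4 ^ (d + 1) * (S + c₁ * |I₁ - I₂|) := by gcongr
    _ ≤ 4 ^ (d + 1) * (S + c₁ * ((‖p₁ - p₂‖ + 3 * δ * r) *
        ((3 * r) ^ d * unitBallVolume d))) := by gcongr
    _ = _ := by rw [mul_pow]; ring

end LowerBounds

/-- The constant comparing offset and tilt with the distance at the base scale. -/
def tiltConst (d : ℕ) : ℝ := 45 * (16 * d) ^ d

/-- The constant comparing the density gap with the distance at the base scale. -/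
def densityConst (d : ℕ) : ℝ := 4 ^ (d + 1) * (1 + 3 ^ d * (6 * d * tiltConst d))

/-- The quasi-monotonicity constant. -/
def monotoneConst (d : ℕ) : ℝ := 3 ^ d * (6 * d * tiltConst d + 3 * densityConst d)

section Comparison

variable {E : Type*} [NormedAddCommGroup E] [InnerProductSpace ℝ E] {d : ℕ}

/-- A bound at scale `r` propagates to every larger scale `t * r`, in isometric coordinates. -/
lemma scale_bound [Nontrivial E] (hd : 0 < d) {x p₁ p₂ : E} {r c₁ c₂ S : ℝ} (hr : 0 < r)
    (hc₁ : 0 ≤ c₁)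
    (ι₁ ι₂ : EuclideanSpace ℝ (Fin d) →ₗᵢ[ℝ] E) (Q : E →ₗ[ℝ] E) (hQ : ∀ y, ‖Q y‖ ≤ ‖y‖)
    (hQ₂ : ∀ w, Q (ι₂ w) = 0) (hQa : Q (p₁ - p₂) = p₁ - p₂) (ha : ‖p₁ - p₂‖ ≤ r)
    (hp₁ : ‖p₁ - x‖ ≤ r / 2) {e : EuclideanSpace ℝ (Fin d)} (he : ‖e‖ = 1)
    (hε : ∀ w, ‖Q (ι₁ w)‖ ≤ d * ‖Q (ι₁ e)‖ * ‖w‖)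
    (hι : ∀ w, ‖ι₁ w - ι₂ w‖ ≤ d * (2 * ‖Q (ι₁ e)‖) * ‖w‖)
    {z : EuclideanSpace ℝ (Fin d)} (hz : ‖p₂ + ι₂ z - x‖ ≤ r / 2)
    (hS : ∀ f ∈ LipIn x r, |c₁ * ∫ w, f (p₁ + ι₁ w) ∂(μH[(d : ℝ)]) -
      c₂ * ∫ w, f (p₂ + ι₂ w) ∂(μH[(d : ℝ)])| ≤ S) {t : ℝ} (ht : 1 ≤ t) {f : E → ℝ}
    (hf : f ∈ LipIn x (t * r)) :
    |c₁ * ∫ w, f (p₁ + ι₁ w) ∂(μH[(d : ℝ)]) - c₂ * ∫ w, f (p₂ + ι₂ w) ∂(μH[(d : ℝ)])| ≤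
      t ^ (d + 1) * (monotoneConst d * S) := by
  have hd1 : (1 : ℝ) ≤ d := by exact_mod_cast hd
  have hω := unitBallVolume_pos d
  have hp₂ : ‖p₂ - x‖ ≤ 2 * r := by
    have : p₂ - x = (p₁ - x) - (p₁ - p₂) := by abel
    rw [this]
    exact (norm_sub_le _ _).trans (by linarith)
  have hp₁' : ‖p₁ - x‖ ≤ 2 * r := by linarith
  have htr : r ≤ t * r := by nlinarith
  have hbase := offset_tilt_le hd hr hc₁ ι₁ ι₂ Q hQ hQ₂ hQa ha hp₁ he hε hS
  have hdens := density_sub_le hr hc₁ ι₁ ι₂ hp₁' hp₂ (by positivity) hι hz hS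
  have hup := LipIn.abs_weighted_sub_le (p₁ := p₁) (p₂ := p₂) (c₂ := c₂) (by positivity) hf ι₁ ι₂ (by linarith)
    (by linarith) (by positivity) hι hc₁
  set a := ‖p₁ - p₂‖
  set ε := ‖Q (ι₁ e)‖
  have ha0 : 0 ≤ a := norm_nonneg _
  have hε0 : 0 ≤ ε := norm_nonneg _
  set Ω := r ^ d * unitBallVolume d with hΩ
  have hΩ0 : 0 ≤ Ω := by positivity
  have hscale : ∀ s, 1 ≤ s → a + 3 * (d * (2 * ε)) * (s * r) ≤ s * (6 * d * (a + r * ε)) := by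
    intro s hs
    have h1 : a ≤ s * (6 * d) * a := le_mul_of_one_le_left ha0 (by nlinarith)
    linarith [h1]
  have hD : |c₁ - c₂| * r * Ω ≤ densityConst d * S := by
    have h1 := hscale 1 le_rfl
    rw [one_mul, one_mul] at h1
    calc _ ≤ _ := hdens
      _ ≤ 4 ^ (d + 1) * (S + 3 ^ d * (c₁ * (6 * d * (a + r * ε)) * Ω)) := by gcongr
      _ = 4 ^ (d + 1) * (S + 3 ^ d * (6 * d * (c₁ * (a + r * ε) * Ω))) := by ring
      _ ≤ 4 ^ (d + 1) * (S + 3 ^ d * (6 * d * (45 * (16 * d) ^ d * S))) := by gcongr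
      _ = _ := by unfold densityConst tiltConst; ring
  calc _ ≤ _ := hup
    _ ≤ (c₁ * (t * (6 * d * (a + r * ε))) + |c₁ - c₂| * (3 * (t * r))) *
        ((3 * (t * r)) ^ d * unitBallVolume d) := by
      gcongr
      exact hscale t ht
    _ = t ^ (d + 1) * (3 ^ d * (6 * d * (c₁ * (a + r * ε) * Ω) + 3 * (|c₁ - c₂| * r * Ω))) := by
      rw [hΩ, mul_pow, mul_pow]; ring
    _ ≤ t ^ (d + 1) * (3 ^ d * (6 * d * (45 * (16 * d) ^ d * S) + 3 * (densityConst d * S))) := by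
      gcongr
    _ = _ := by unfold monotoneConst tiltConst; ring

end Comparison

/-- Quasi-monotonicity of the normalized Wasserstein distance in the
radius: for flat measures whose planes both meet `B(x₀,r/2)`,
`dist_{x₀,2^k r}(μ₁,μ₂) ≤ C dist_{x₀,r}(μ₁,μ₂)` for all `k ∈ ℕ`, `C = C(n,d)`. -/
theorem stmt16 (n d : ℕ) (hd : 0 < d) (hdn : d < n) :
    ∃ C > 0, ∀ (x₀ : EuclideanSpace ℝ (Fin n)) (r : ℝ), 0 < r →
      ∀ (c₁ c₂ : ℝ) (P₁ P₂ : AffineSubspace ℝ (EuclideanSpace ℝ (Fin n)))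
        (μ₁ μ₂ : Measure (EuclideanSpace ℝ (Fin n))),
      0 < c₁ → 0 < c₂ →
      Module.finrank ℝ P₁.direction = d → Module.finrank ℝ P₂.direction = d →
      ((P₁ : Set (EuclideanSpace ℝ (Fin n))) ∩ ball x₀ (r / 2)).Nonempty →
      ((P₂ : Set (EuclideanSpace ℝ (Fin n))) ∩ ball x₀ (r / 2)).Nonempty →
      μ₁ = ENNReal.ofReal c₁ •
        (μH[(d : ℝ)]).restrict (P₁ : Set (EuclideanSpace ℝ (Fin n))) →
      μ₂ = ENNReal.ofReal c₂ •
        (μH[(d : ℝ)]).restrict (P₂ : Set (EuclideanSpace ℝ (Fin n))) →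
      ∀ k : ℕ, wdist d x₀ (2 ^ k * r) μ₁ μ₂ ≤ C * wdist d x₀ r μ₁ μ₂ := by
  have hd' : (0 : ℝ) < d := by exact_mod_cast hd
  refine ⟨monotoneConst d, by unfold monotoneConst densityConst tiltConst; positivity, ?_⟩
  rintro x r hr c₁ c₂ P₁ P₂ μ₁ μ₂ hc₁ hc₂ hP₁ hP₂ ⟨p₁, hp₁, hp₁x⟩ ⟨q, hq, hqx⟩ rfl rfl k
  have : Nonempty (Fin n) := ⟨⟨0, by omega⟩⟩
  have : Nonempty (Fin d) := ⟨⟨0, hd⟩⟩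
  rw [mem_ball, dist_eq_norm] at hp₁x hqx
  obtain ⟨ι₁, ι₂, hι₁, hι₂, hclose⟩ := exists_close_isometries P₁.direction P₂.direction hP₁ hP₂
  set V := P₂.direction
  let Q : EuclideanSpace ℝ (Fin n) →ₗ[ℝ] EuclideanSpace ℝ (Fin n) := Vᗮ.starProjection.toLinearMap
  have hQV : ∀ v ∈ V, Q v = 0 := fun v hv =>
    Submodule.starProjection_orthogonal_apply_eq_zero hv
  have hQle : ∀ y, ‖Q y‖ ≤ ‖y‖ := fun y => Vᗮ.norm_starProjection_apply_le y
  have hsum : ∀ y, V.starProjection y + Q y = y := fun y =>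
    V.starProjection_add_starProjection_orthogonal y
  have hmem : ∀ y, V.starProjection y ∈ V := fun y => V.starProjection_apply_mem y
  let p₂ := q + V.starProjection (p₁ - q)
  have hp₂ : p₂ ∈ P₂ := by
    have := AffineSubspace.vadd_mem_of_mem_direction (hmem (p₁ - q)) hq
    rwa [vadd_eq_add, add_comm] at this
  have hdiff : p₁ - p₂ = Q (p₁ - q) := by
    rw [eq_comm, ← sub_eq_zero]
    have := hsum (p₁ - q)
    simp only [p₂]
    rw [← sub_sub]
    nth_rewrite 2 [← this]
    abel
  have hQa : Q (p₁ - p₂) = p₁ - p₂ := by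
    have h1 := hsum (p₁ - q)
    have h2 := congrArg Q h1
    rw [map_add, hQV _ (hmem _), zero_add] at h2
    rw [hdiff, h2]
  have ha : ‖p₁ - p₂‖ ≤ r := by
    rw [hdiff]
    have : p₁ - q = (p₁ - x) - (q - x) := by abel
    have h2 := norm_sub_le (p₁ - x) (q - x)
    rw [← this] at h2
    exact (hQle _).trans (by linarith)
  have hp₂x : ‖p₂ - x‖ ≤ 2 * r := by
    have : p₂ - x = (p₁ - x) - (p₁ - p₂) := by abel
    rw [this]
    exact (norm_sub_le _ _).trans (by linarith)
  obtain ⟨z, hz⟩ : ∃ z, ι₂ z = q - p₂ := by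
    have : q - p₂ ∈ (V : Set _) := AffineSubspace.vsub_mem_direction hq hp₂
    rwa [← hι₂] at this
  have hz' : ‖p₂ + ι₂ z - x‖ ≤ r / 2 := by
    rw [hz, add_sub_cancel]
    exact hqx.le
  obtain ⟨i, hi⟩ := Finite.exists_max fun i => ‖Q (ι₁ (EuclideanSpace.basisFun (Fin d) ℝ i))‖
  set e := EuclideanSpace.basisFun (Fin d) ℝ i
  have he : ‖e‖ = 1 := (EuclideanSpace.basisFun (Fin d) ℝ).orthonormal.1 i
  have hε := norm_apply_le_of_basis (Q ∘ₗ ι₁.toLinearMap) hi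
  have hι := norm_apply_le_of_basis (ι₁.toLinearMap - ι₂.toLinearMap) (δ := 2 * ‖Q (ι₁ e)‖)
    fun j => (hclose j).trans (mul_le_mul_of_nonneg_left (hi j) zero_le_two)
  have hQ₂ : ∀ w, Q (ι₂ w) = 0 := fun w => hQV _ (by
    rw [← SetLike.mem_coe, ← hι₂]
    exact mem_range_self w)
  have ht : (1 : ℝ) ≤ 2 ^ k := one_le_pow₀ one_le_two
  refine wdist_le_of_bound hr (by positivity) _ _ ?_ ?_
  · refine bddAbove_def.2 ⟨?_, ?_⟩
    rotate_left
    · rintro _ ⟨f, rfl⟩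
      dsimp only
      rw [integral_flat P₁ hp₁ ι₁ hι₁ hc₁.le, integral_flat P₂ hp₂ ι₂ hι₂ hc₂.le]
      exact LipIn.abs_weighted_sub_le (p₁ := p₁) (p₂ := p₂) hr f.2 ι₁ ι₂ (by linarith) hp₂x
        (by positivity) hι hc₁.le
  · intro S hS f hf
    simp only [integral_flat P₁ hp₁ ι₁ hι₁ hc₁.le, integral_flat P₂ hp₂ ι₂ hι₂ hc₂.le] at hS ⊢
    exact scale_bound hd hr hc₁.le ι₁ ι₂ Q hQle hQ₂ hQa ha hp₁x.le he hε hι hz' hS ht hf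
end
end
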